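/- Let n ≥ 1. Let S be a finite nonempty family of distinct unit lattice cubes in ℝⁿ such that: (i) the simple graph on S whose edges are the adjacent pairs of cubes is connected and acyclic (a tree), and (ii) any two cubes of S that are not adjacent are disjoint. Then the union ⋃ S is homeomorphic to the cube [0,1]ⁿ (in particular, it is an n-cell). -/

import Mathlib

open Set

/-- The unit lattice cube `v + [0,1]ⁿ` in `ℝⁿ`, for `v ∈ ℤⁿ`. -/
def latticeCube {n : ℕ} (v : Fin n → ℤ) : Set (EuclideanSpace ℝ (Fin n)) :=
  {x | ∀ i, (v i : ℝ) ≤ x i ∧ x i ≤ (v i : ℝ) + 1}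

/-- Two unit lattice cubes are adjacent if their base vertices differ by a standard
basis vector, i.e. they share a common `(n-1)`-dimensional face. -/
def cubeAdj {n : ℕ} (v w : Fin n → ℤ) : Prop :=
  ∃ k : Fin n, w = v + Pi.single k 1 ∨ v = w + Pi.single k 1

/-- The adjacency graph of a finite family `S` of unit lattice cubes (indexed by
their base vertices). -/
def cubeGraph {n : ℕ} (S : Finset (Fin n → ℤ)) : SimpleGraph ↥S :=
  SimpleGraph.fromRel fun a b =>
    ∃ k : Fin n, (b : Fin n → ℤ) = (a : Fin n → ℤ) + Pi.single k 1

/-- The unit cube `[0,1]ⁿ` in `ℝⁿ`. -/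
def unitCube (n : ℕ) : Set (EuclideanSpace ℝ (Fin n)) :=
  {x | ∀ i, x i ∈ Icc (0 : ℝ) 1}

/-- The lattice points `v` and `w` differ by a unit step in the direction `k`. -/
def UnitStep {n : ℕ} (k : Fin n) (v w : Fin n → ℤ) : Prop :=
  (w k = v k + 1 ∨ v k = w k + 1) ∧ ∀ i, i ≠ k → w i = v i

theorem unitStep_of_eq_add_single {n : ℕ} {k : Fin n} {v w : Fin n → ℤ}
    (h : w = v + Pi.single k 1 ∨ v = w + Pi.single k 1) : UnitStep k v w := by
  rcases h with rfl | rfl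
  · exact ⟨Or.inl (by simp), fun i hi => by simp [hi]⟩
  · exact ⟨Or.inr (by simp), fun i hi => by simp [hi]⟩

theorem exists_unitStep_of_cubeGraph_adj {n : ℕ} {S : Finset (Fin n → ℤ)} {a b : ↥S}
    (h : (cubeGraph S).Adj a b) : ∃ k, UnitStep k (a : Fin n → ℤ) b := by
  rw [cubeGraph, SimpleGraph.fromRel_adj] at h
  rcases h.2 with ⟨k, hk⟩ | ⟨k, hk⟩
  · exact ⟨k, unitStep_of_eq_add_single (Or.inl hk)⟩
  · exact ⟨k, unitStep_of_eq_add_single (Or.inr hk)⟩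

/-- Lattice cubes whose base vertices differ by at most one in each coordinate intersect. -/
theorem not_disjoint_latticeCube {n : ℕ} {v w : Fin n → ℤ}
    (h : ∀ i, v i ≤ w i + 1 ∧ w i ≤ v i + 1) :
    ¬ Disjoint (latticeCube v) (latticeCube w) := by
  rw [Set.not_disjoint_iff]
  refine ⟨WithLp.toLp 2 fun i => ((max (v i) (w i) : ℤ) : ℝ), fun i => ?_, fun i => ?_⟩
  · have := h i
    change (v i : ℝ) ≤ ((max (v i) (w i) : ℤ) : ℝ) ∧ ((max (v i) (w i) : ℤ) : ℝ) ≤ (v i : ℝ) + 1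
    exact_mod_cast (by omega : v i ≤ max (v i) (w i) ∧ max (v i) (w i) ≤ v i + 1)
  · have := h i
    change (w i : ℝ) ≤ ((max (v i) (w i) : ℤ) : ℝ) ∧ ((max (v i) (w i) : ℤ) : ℝ) ≤ (w i : ℝ) + 1
    exact_mod_cast (by omega : w i ≤ max (v i) (w i) ∧ max (v i) (w i) ≤ w i + 1)

/-- If non-adjacent cubes are disjoint, all neighbours of a cube lie in a common direction. -/
theorem unitStep_direction_unique {n : ℕ} {S : Finset (Fin n → ℤ)}
    (hdisj : ∀ v ∈ S, ∀ w ∈ S, v ≠ w → ¬ cubeAdj v w →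
      Disjoint (latticeCube v) (latticeCube w))
    {x v w : Fin n → ℤ} (hv : v ∈ S) (hw : w ∈ S) {i j : Fin n}
    (hi : UnitStep i x v) (hj : UnitStep j x w) : i = j := by
  by_contra hij
  have hvj := hi.2 j (Ne.symm hij)
  have hwi := hj.2 i hij
  have hi1 := hi.1
  have hj1 := hj.1
  refine not_disjoint_latticeCube (v := v) (w := w) (fun m => ?_) (hdisj v hv w hw ?_ ?_)
  · by_cases hmi : m = i
    · subst hmi; omega
    · have h1 := hi.2 m hmi
      by_cases hmj : m = j
      · subst hmj; omega
      · have h2 := hj.2 m hmj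
        omega
  · rintro rfl
    omega
  · rintro ⟨k, hk⟩
    have hk := unitStep_of_eq_add_single hk
    by_cases hik : i = k
    · have := hk.2 j (fun h => hij (hik.trans h.symm))
      omega
    · have := hk.2 i hik
      omega

/-- All steps between members of a connected family of lattice cubes, whose non-adjacent
members are disjoint, are in a common direction. -/
theorem exists_common_direction {n : ℕ} (hn : 1 ≤ n) {S : Finset (Fin n → ℤ)}
    (hconn : (cubeGraph S).Connected)
    (hdisj : ∀ v ∈ S, ∀ w ∈ S, v ≠ w → ¬ cubeAdj v w →
      Disjoint (latticeCube v) (latticeCube w)) :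
    ∃ k, ∀ a b : ↥S, (cubeGraph S).Adj a b → UnitStep k (a : Fin n → ℤ) b := by
  by_cases h : ∃ a b : ↥S, (cubeGraph S).Adj a b
  · obtain ⟨r, s, hrs⟩ := h
    obtain ⟨k, hk⟩ := exists_unitStep_of_cubeGraph_adj hrs
    refine ⟨k, fun a => ?_⟩
    have hra := (SimpleGraph.reachable_iff_reflTransGen r a).1 (hconn.preconnected r a)
    induction hra with
    | refl =>
      intro b hb
      obtain ⟨j, hj⟩ := exists_unitStep_of_cubeGraph_adj hb
      rwa [unitStep_direction_unique hdisj s.2 b.2 hk hj]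
    | @tail x y _ hxy ih =>
      intro b hb
      obtain ⟨j, hj⟩ := exists_unitStep_of_cubeGraph_adj hb
      obtain ⟨l, hl⟩ := exists_unitStep_of_cubeGraph_adj hxy.symm
      have hyx : UnitStep k (y : Fin n → ℤ) x :=
        ⟨(ih y hxy).1.symm, fun i hi => ((ih y hxy).2 i hi).symm⟩
      rwa [unitStep_direction_unique hdisj x.2 b.2 hyx hj]
  · exact ⟨⟨0, hn⟩, fun a b hab => (h ⟨a, b, hab⟩).elim⟩

/-- In a connected family of lattice cubes all of whose steps are in the direction `k`, any two
members lie on a line in that direction, and every lattice point between them is a member. -/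
theorem line_of_common_direction {n : ℕ} {S : Finset (Fin n → ℤ)}
    (hconn : (cubeGraph S).Connected) {k : Fin n}
    (hk : ∀ a b : ↥S, (cubeGraph S).Adj a b → UnitStep k (a : Fin n → ℤ) b) (r w : ↥S) :
    (∀ i, i ≠ k → w.1 i = r.1 i) ∧
      ∀ t ∈ Set.uIcc (r.1 k) (w.1 k), Function.update r.1 k t ∈ S := by
  have hrw := (SimpleGraph.reachable_iff_reflTransGen r w).1 (hconn.preconnected r w)
  induction hrw with
  | refl =>
    refine ⟨fun _ _ => rfl, fun t ht => ?_⟩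
    obtain rfl : t = r.1 k := by simpa using ht
    simp
  | @tail x y _ hxy ih =>
    obtain ⟨h1, h2⟩ := hk x y hxy
    have h3 : ∀ i, i ≠ k → y.1 i = r.1 i := fun i hi => (h2 i hi).trans (ih.1 i hi)
    refine ⟨h3, fun t ht => ?_⟩
    rw [Set.mem_uIcc] at ht
    by_cases hty : t = y.1 k
    · have : Function.update r.1 k t = y.1 := by
        funext i
        by_cases hi : i = k
        · subst hi; simp [hty]
        · simp [hi, h3 i hi]
      rw [this]
      exact y.2
    · apply ih.2
      rw [Set.mem_uIcc]
      omega

/-- A nondegenerate closed box is homeomorphic to the unit cube. -/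
noncomputable def boxHomeomorphUnitCube {n : ℕ} (lo hi : Fin n → ℝ) (h : ∀ i, lo i < hi i) :
    ↥{x : EuclideanSpace ℝ (Fin n) | ∀ i, lo i ≤ x i ∧ x i ≤ hi i} ≃ₜ ↥(unitCube n) where
  toFun x := ⟨WithLp.toLp 2 fun i => (x.1 i - lo i) * (hi i - lo i)⁻¹, fun i => by
    have h0 : 0 < hi i - lo i := sub_pos.2 (h i)
    have hx := x.2 i
    refine ⟨mul_nonneg (sub_nonneg.2 hx.1) (inv_nonneg.2 h0.le), ?_⟩
    change (x.1 i - lo i) * (hi i - lo i)⁻¹ ≤ 1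
    rw [← div_eq_mul_inv, div_le_one h0]
    linarith⟩
  invFun y := ⟨WithLp.toLp 2 fun i => lo i + y.1 i * (hi i - lo i), fun i => by
    have h0 : 0 < hi i - lo i := sub_pos.2 (h i)
    have hy := y.2 i
    change lo i ≤ lo i + y.1 i * (hi i - lo i) ∧ lo i + y.1 i * (hi i - lo i) ≤ hi i
    constructor <;> nlinarith [hy.1, hy.2]⟩
  left_inv x := by
    ext i
    have h0 : hi i - lo i ≠ 0 := (sub_pos.2 (h i)).ne'
    simp [h0]
  right_inv y := by
    ext i
    have h0 : hi i - lo i ≠ 0 := (sub_pos.2 (h i)).ne'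
    simp [h0]
  continuous_toFun := by fun_prop
  continuous_invFun := by fun_prop

/-- A tunnel is an `n`-cell: if a finite nonempty family of distinct unit lattice
cubes has a tree as adjacency graph and its non-adjacent cubes are disjoint, then
the union of the cubes is homeomorphic to `[0,1]ⁿ`. -/
theorem tunnel_is_cell (n : ℕ) (hn : 1 ≤ n) (S : Finset (Fin n → ℤ))
    (hS : S.Nonempty)
    (htree : (cubeGraph S).IsTree)
    (hdisj : ∀ v ∈ S, ∀ w ∈ S, v ≠ w → ¬ cubeAdj v w →
      Disjoint (latticeCube v) (latticeCube w)) :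
    Nonempty (↥(⋃ v ∈ S, latticeCube v) ≃ₜ ↥(unitCube n)) := by
  have hconn := htree.connected
  obtain ⟨k, hk⟩ := exists_common_direction hn hconn hdisj
  obtain ⟨p, hpS, hp⟩ := S.exists_min_image (fun v => v k) hS
  obtain ⟨q, hqS, hq⟩ := S.exists_max_image (fun v => v k) hS
  have hline := line_of_common_direction hconn hk ⟨p, hpS⟩
  have hpq : ∀ i, p i ≤ q i := fun i => by
    by_cases hi : i = k
    · exact hi ▸ hp q hqS
    · exact ((hline ⟨q, hqS⟩).1 i hi).ge
  have hunion : (⋃ v ∈ S, latticeCube v) =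
      {x : EuclideanSpace ℝ (Fin n) | ∀ i, (p i : ℝ) ≤ x i ∧ x i ≤ (q i : ℝ) + 1} := by
    ext x
    simp only [Set.mem_iUnion, exists_prop, Set.mem_ofPred_eq]
    constructor
    · rintro ⟨v, hv, hx⟩ i
      have h1 : p i ≤ v i ∧ v i ≤ q i := by
        by_cases hi : i = k
        · subst hi
          exact ⟨hp v hv, hq v hv⟩
        · have h2 := (hline ⟨v, hv⟩).1 i hi
          have h3 := (hline ⟨q, hqS⟩).1 i hi
          exact ⟨h2.ge, (h2.trans h3.symm).le⟩
      have h2 : (p i : ℝ) ≤ v i := by exact_mod_cast h1.1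
      have h3 : (v i : ℝ) ≤ q i := by exact_mod_cast h1.2
      have := hx i
      constructor <;> linarith
    · intro hx
      have hpx : p k ≤ ⌊x k⌋ := Int.le_floor.2 (hx k).1
      refine ⟨Function.update p k (min ⌊x k⌋ (q k)), (hline ⟨q, hqS⟩).2 _ ?_, fun i => ?_⟩
      · rw [Set.uIcc_of_le (hpq k)]
        exact ⟨le_min hpx (hpq k), min_le_right _ _⟩
      · by_cases hi : i = k
        · subst hi
          rw [Function.update_self]
          constructor
          · exact le_trans (by exact_mod_cast min_le_left _ _) (Int.floor_le (x i))
          · rcases min_choice ⌊x i⌋ (q i) with h | h <;> rw [h]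
            · exact (Int.lt_floor_add_one (x i)).le
            · exact (hx i).2
        · rw [Function.update_of_ne hi]
          have h3 : q i = p i := (hline ⟨q, hqS⟩).1 i hi
          have := hx i
          rwa [h3] at this
  rw [hunion]
  refine ⟨boxHomeomorphUnitCube (fun i => (p i : ℝ)) (fun i => (q i : ℝ) + 1) fun i => ?_⟩
  have : (p i : ℝ) ≤ q i := by exact_mod_cast hpq i
  linarith
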